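/- Let g ≥ 4 and let δ = (δ_{il})_{1≤i,l≤g} be a nonzero g×g matrix with entries in 𝔽_{p²}. Then there exists a tuple (a_1, …, a_g) ∈ k^g which is linearly independent over 𝔽_{p²} and satisfies the self-duality relations R_g, such that the 3×g matrix over k whose three rows are (σ²(a_1), …, σ²(a_g)), (a_1, …, a_g), and (σ(∑_{l=1}^g δ_{1l}·a_l), …, σ(∑_{l=1}^g δ_{gl}·a_l)) has rank 3. -/

import Mathlib

open Finset

/-- The self-duality relations `R_g` on a tuple `(a_1, …, a_g)` (indexed here by `1, …, g`):
for `g` even, `∑_{i=1}^{g/2−1}(−a_{g+1−i}·σ^j(a_i) + σ^j(a_{g+1−i})·a_i)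
= −a_{g/2}·σ^j(a_{g/2+1}) + σ^j(a_{g/2})·a_{g/2+1}` for every even `j` with `1 ≤ j < g−1`;
for `g` odd with `m = (g+1)/2`, `∑_{i=1}^{(g−1)/2}(a_{g+1−i}·σ^j(a_i) + σ^j(a_{g+1−i})·a_i)
= (−1)^m·a_m·σ^j(a_m)` for every odd `j` with `1 ≤ j < g−1`. -/
def SelfDualRelations (p : ℕ) [Fact p.Prime] {k : Type*} [Field k] [IsAlgClosed k] [CharP k p]
    (g : ℕ) (a : ℕ → k) : Prop :=
  if Even g then
    ∀ j : ℕ, 1 ≤ j → j < g - 1 → Even j →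
      ∑ i ∈ Finset.Icc 1 (g / 2 - 1),
        (-(a (g + 1 - i)) * ((frobeniusEquiv k p : RingAut k) ^ j) (a i)
          + ((frobeniusEquiv k p : RingAut k) ^ j) (a (g + 1 - i)) * a i)
        = -(a (g / 2)) * ((frobeniusEquiv k p : RingAut k) ^ j) (a (g / 2 + 1))
          + ((frobeniusEquiv k p : RingAut k) ^ j) (a (g / 2)) * a (g / 2 + 1)
  else
    ∀ j : ℕ, 1 ≤ j → j < g - 1 → Odd j →
      ∑ i ∈ Finset.Icc 1 ((g - 1) / 2),
        (a (g + 1 - i) * ((frobeniusEquiv k p : RingAut k) ^ j) (a i)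
          + ((frobeniusEquiv k p : RingAut k) ^ j) (a (g + 1 - i)) * a i)
        = (-1 : k) ^ ((g + 1) / 2) * a ((g + 1) / 2)
          * ((frobeniusEquiv k p : RingAut k) ^ j) (a ((g + 1) / 2))

section

variable {p : ℕ} [Fact p.Prime] {k : Type*} [Field k] [CharP k p]

local notation "Φ" => iterateFrobenius k p

theorem iterateFrobenius_iterate (i j : ℕ) (x : k) : Φ i (Φ j x) = Φ (i + j) x :=
  (iterateFrobenius_add_apply k p i j x).symm

theorem iterateFrobenius_mul_of_fixed {n : ℕ} {x : k} (hx : Φ n x = x) (s : ℕ) :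
    Φ (n * s) x = x := by
  induction s with
  | zero => simp
  | succ s ih => rw [mul_add, mul_one, ← iterateFrobenius_iterate, hx, ih]

theorem iterateFrobenius_fixed {n : ℕ} {x : k} (hx : Φ n x = x) (s : ℕ) :
    Φ n (Φ s x) = Φ s x := by
  rw [iterateFrobenius_iterate, add_comm, ← iterateFrobenius_iterate, hx]

theorem sum_frobenius_dual {n : ℕ} {x y : ℕ → k}
    (hdual : ∀ i ∈ Icc 1 n, ∀ l ∈ Icc 1 n,
      ∑ s ∈ range n, Φ (2 * s) (x i) * Φ (2 * s) (y l) = if i = l then 1 else 0)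
    {s t : ℕ} (hs : s < n) (ht : t < n) :
    ∑ i ∈ Icc 1 n, Φ (2 * s) (x i) * Φ (2 * t) (y i) = if s = t then 1 else 0 := by
  let A : Matrix (Icc 1 n) (Fin n) k := Matrix.of fun i s => Φ (2 * (s : ℕ)) (x i)
  let B : Matrix (Fin n) (Icc 1 n) k := Matrix.of fun s i => Φ (2 * (s : ℕ)) (y i)
  have hAB : A * B = 1 := by
    ext i l
    rw [Matrix.mul_apply, Matrix.one_apply]
    have := hdual i i.2 l l.2
    rw [sum_range] at this
    simp only [Subtype.ext_iff]
    exact this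
  have e : Icc 1 n ≃ Fin n := Fintype.equivOfCardEq (by simp)
  have hBA : B * A = 1 := (Matrix.mul_eq_one_comm_of_equiv e).1 hAB
  have := congrFun (congrFun hBA ⟨t, ht⟩) ⟨s, hs⟩
  rw [Matrix.mul_apply, Matrix.one_apply] at this
  simp only [Fin.mk.injEq] at this
  rw [if_congr eq_comm rfl rfl, ← this, ← sum_coe_sort]
  exact sum_congr rfl fun i _ => mul_comm _ _

theorem eq_zero_of_sum_dual {n : ℕ} {x y : ℕ → k}
    (hdual : ∀ i ∈ Icc 1 n, ∀ l ∈ Icc 1 n,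
      ∑ s ∈ range n, Φ (2 * s) (x i) * Φ (2 * s) (y l) = if i = l then 1 else 0)
    {c : ℕ → k} (hc : ∀ i, Φ 2 (c i) = c i) (h : ∑ i ∈ Icc 1 n, c i * x i = 0) :
    ∀ i ∈ Icc 1 n, c i = 0 := by
  intro l hl
  calc c l = ∑ i ∈ Icc 1 n, c i * (if i = l then 1 else 0) := by simp [hl]
    _ = ∑ i ∈ Icc 1 n, c i * ∑ s ∈ range n, Φ (2 * s) (x i) * Φ (2 * s) (y l) :=
      sum_congr rfl fun i hi => by rw [hdual i hi l hl]
    _ = ∑ s ∈ range n, Φ (2 * s) (∑ i ∈ Icc 1 n, c i * x i) * Φ (2 * s) (y l) := by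
      simp_rw [mul_sum, map_sum, sum_mul, map_mul]
      rw [sum_comm]
      refine sum_congr rfl fun s _ => sum_congr rfl fun i _ => ?_
      rw [iterateFrobenius_mul_of_fixed (hc i)]
      ring
    _ = 0 := by simp [h]

variable [IsAlgClosed k]

theorem exists_dual_families (n : ℕ) (hn : 0 < n) : ∃ x y : ℕ → k,
    (∀ i, Φ (2 * n) (x i) = x i) ∧ (∀ i, Φ (2 * n) (y i) = y i) ∧
    ∀ i ∈ Icc 1 n, ∀ l ∈ Icc 1 n,
      ∑ s ∈ range n, Φ (2 * s) (x i) * Φ (2 * s) (y l) = if i = l then 1 else 0 := by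
  have : NeZero n := ⟨hn.ne'⟩
  let F := GaloisField p 2
  let E := FiniteField.Extension F p n
  have hF : Nat.card F = p ^ 2 := GaloisField.card p 2 two_ne_zero
  have hE : Nat.card E = p ^ (2 * n) := by
    rw [FiniteField.natCard_extension, hF, pow_mul]
  have hfr : Module.finrank F E = n := FiniteField.finrank_extension F p n
  let : Algebra (ZMod p) k := ZMod.algebra k p
  let φ : E →ₐ[ZMod p] k := IsAlgClosed.lift
  have hfix : ∀ u : E, Φ (2 * n) (φ u) = φ u := by
    intro u
    let := Fintype.ofFinite E
    rw [iterateFrobenius_def, ← map_pow, ← hE, Nat.card_eq_fintype_card, FiniteField.pow_card]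
  let b : Module.Basis (Icc 1 n) F E := (Module.finBasisOfFinrankEq F E hfr).reindex
    (Fintype.equivOfCardEq (by simp))
  refine ⟨fun i => if h : i ∈ Icc 1 n then φ (b ⟨i, h⟩) else 0,
    fun i => if h : i ∈ Icc 1 n then φ (b.traceDual ⟨i, h⟩) else 0, ?_, ?_, ?_⟩
  · intro i
    dsimp only
    split_ifs
    · exact hfix _
    · simp
  · intro i
    dsimp only
    split_ifs
    · exact hfix _
    · simp
  · intro i hi l hl
    have h1 := b.trace_mul_traceDual ⟨i, hi⟩ ⟨l, hl⟩
    have h2 := FiniteField.algebraMap_trace_eq_sum_pow F E (b ⟨i, hi⟩ * b.traceDual ⟨l, hl⟩)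
    rw [h1, hfr, hF] at h2
    have h3 := congrArg φ h2
    simp only [dif_pos hi, dif_pos hl, iterateFrobenius_def]
    rw [map_sum] at h3
    simp_rw [pow_mul, ← map_pow, ← map_mul, ← mul_pow]
    rw [← h3]
    by_cases hil : i = l <;> simp [hil]
end

section

variable (p : ℕ) [Fact p.Prime] {k : Type*} [Field k]

/-- Linear independence over `𝔽_{p²}` of the entries `a 1, …, a g`. -/
def QuadIndependent (g : ℕ) (a : ℕ → k) : Prop :=
  ∀ c : ℕ → k, (∀ i, c i ^ p ^ 2 = c i) →
    ∑ i ∈ Icc 1 g, c i * a i = 0 → ∀ i ∈ Icc 1 g, c i = 0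

/-- The signs of the antidiagonal Gram matrix of `dualityForm`. -/
def dualitySign (k : Type*) [Field k] (g i : ℕ) : k :=
  if Even g then (if i ≤ g / 2 then -1 else 1)
  else (if i = (g + 1) / 2 then -(-1) ^ ((g + 1) / 2) else 1)

/-- The bilinear form whose values `dualityForm g a (σ^j a)` are the self-duality relations. -/
def dualityForm (g : ℕ) (a b : ℕ → k) : k :=
  ∑ i ∈ Icc 1 g, dualitySign k g i * a (g + 1 - i) * b i

theorem sum_Icc_reflect {M : Type*} [AddCommMonoid M] (g : ℕ) (f : ℕ → M) :
    ∑ i ∈ Icc 1 g, f (g + 1 - i) = ∑ i ∈ Icc 1 g, f i := by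
  refine sum_nbij' (fun i => g + 1 - i) (fun i => g + 1 - i) ?_ ?_ ?_ ?_ ?_ <;>
  intro i hi <;> simp only [mem_Icc] at * <;> omega

theorem sum_Icc_add_reflect {M : Type*} [AddCommMonoid M] (n m : ℕ) (f : ℕ → M) :
    ∑ i ∈ Icc 1 (n + m), f i =
      ∑ i ∈ Icc 1 n, f i + ∑ i ∈ Icc 1 m, f (n + m + 1 - i) := by
  have h : Icc 1 (n + m) = Icc 1 n ∪ Icc (n + 1) (n + m) := by
    ext i
    simp only [mem_union, mem_Icc]
    omega
  rw [h, sum_union]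
  · congr 1
    refine sum_nbij' (fun i => n + m + 1 - i) (fun i => n + m + 1 - i) ?_ ?_ ?_ ?_ ?_ <;>
    intro i hi <;> simp only [mem_Icc] at * <;> first | omega | (congr 1; omega)
  · rw [disjoint_left]
    intro i
    simp only [mem_Icc]
    omega

theorem sum_Icc_even {M : Type*} [AddCommMonoid M] (n : ℕ) (f : ℕ → M) :
    ∑ i ∈ Icc 1 (2 * n), f i = ∑ i ∈ Icc 1 n, (f i + f (2 * n + 1 - i)) := by
  rw [two_mul, sum_Icc_add_reflect, sum_add_distrib]

theorem sum_Icc_odd {M : Type*} [AddCommMonoid M] (n : ℕ) (f : ℕ → M) :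
    ∑ i ∈ Icc 1 (2 * n + 1), f i =
      ∑ i ∈ Icc 1 n, (f i + f (2 * n + 1 + 1 - i)) + f (n + 1) := by
  rw [show 2 * n + 1 = (n + 1) + n by ring, sum_Icc_add_reflect,
    sum_Icc_succ_top (by omega), sum_add_distrib, add_right_comm]

theorem dualityForm_even (n : ℕ) (a b : ℕ → k) :
    dualityForm (2 * n) a b =
      ∑ i ∈ Icc 1 n, (-a (2 * n + 1 - i) * b i + a i * b (2 * n + 1 - i)) := by
  rw [dualityForm, sum_Icc_even]
  refine sum_congr rfl fun i hi => ?_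
  rw [mem_Icc] at hi
  have h1 : dualitySign k (2 * n) i = -1 := by
    rw [dualitySign, if_pos (by simp), if_pos (by omega)]
  have h2 : dualitySign k (2 * n) (2 * n + 1 - i) = 1 := by
    rw [dualitySign, if_pos (by simp), if_neg (by omega)]
  rw [h1, h2, show 2 * n + 1 - (2 * n + 1 - i) = i by omega]
  ring

theorem dualityForm_odd (n : ℕ) (a b : ℕ → k) :
    dualityForm (2 * n + 1) a b =
      ∑ i ∈ Icc 1 n, (a (2 * n + 1 + 1 - i) * b i + a i * b (2 * n + 1 + 1 - i))
        - (-1) ^ (n + 1) * a (n + 1) * b (n + 1) := by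
  have h0 : ¬ Even (2 * n + 1) := by simp
  have h3 : dualitySign k (2 * n + 1) (n + 1) = -(-1) ^ (n + 1) := by
    rw [dualitySign, if_neg h0, if_pos (by omega), show (2 * n + 1 + 1) / 2 = n + 1 by omega]
  rw [dualityForm, sum_Icc_odd, h3, show 2 * n + 1 + 1 - (n + 1) = n + 1 by omega, sub_eq_add_neg]
  congr 1
  · refine sum_congr rfl fun i hi => ?_
    rw [mem_Icc] at hi
    have h1 : dualitySign k (2 * n + 1) i = 1 := by
      rw [dualitySign, if_neg h0, if_neg (by omega)]
    have h2 : dualitySign k (2 * n + 1) (2 * n + 1 + 1 - i) = 1 := by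
      rw [dualitySign, if_neg h0, if_neg (by omega)]
    rw [h1, h2, show 2 * n + 1 + 1 - (2 * n + 1 + 1 - i) = i by omega]
    ring
  · ring

theorem dualityForm_eq_sum (g : ℕ) (a b : ℕ → k) :
    dualityForm g a b =
      ∑ i ∈ Icc 1 g, dualitySign k g (g + 1 - i) * b (g + 1 - i) * a i := by
  rw [dualityForm, ← sum_Icc_reflect]
  refine sum_congr rfl fun i hi => ?_
  rw [mem_Icc] at hi
  rw [show g + 1 - (g + 1 - i) = i by omega]
  ring

theorem dualitySign_ne_zero (g i : ℕ) : dualitySign k g i ≠ 0 := by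
  unfold dualitySign
  split_ifs <;> simp

theorem dualityForm_swap (g : ℕ) (a b : ℕ → k) :
    dualityForm g b a = (if Even g then -1 else 1) * dualityForm g a b := by
  rcases Nat.even_or_odd' g with ⟨n, rfl | rfl⟩
  · rw [dualityForm_even, dualityForm_even, if_pos (by simp), mul_sum]
    exact sum_congr rfl fun i _ => by ring
  · rw [dualityForm_odd, dualityForm_odd, if_neg (by simp), one_mul]
    congr 1
    · exact sum_congr rfl fun i _ => by ring
    · ring

theorem dualityForm_add_smul_left (g : ℕ) (a v b : ℕ → k) (c : k) :
    dualityForm g (fun i => a i + c * v i) b = dualityForm g a b + c * dualityForm g v b := by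
  simp only [dualityForm, mul_sum, ← sum_add_distrib]
  exact sum_congr rfl fun i _ => by ring

theorem dualityForm_add_smul_right (g : ℕ) (a v b : ℕ → k) (c : k) :
    dualityForm g b (fun i => a i + c * v i) = dualityForm g b a + c * dualityForm g b v := by
  simp only [dualityForm, mul_sum, ← sum_add_distrib]
  exact sum_congr rfl fun i _ => by ring

theorem map_dualitySign (f : k →+* k) (g i : ℕ) : f (dualitySign k g i) = dualitySign k g i := by
  unfold dualitySign
  split_ifs <;> simp

theorem map_dualityForm (f : k →+* k) (g : ℕ) (a b : ℕ → k) :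
    f (dualityForm g a b) = dualityForm g (fun i => f (a i)) (fun i => f (b i)) := by
  simp [dualityForm, map_sum, map_dualitySign]

variable [CharP k p]

theorem frobeniusEquiv_pow_apply [PerfectRing k p] (j : ℕ) (x : k) :
    ((frobeniusEquiv k p : RingAut k) ^ j) x = iterateFrobenius k p j x := by
  induction j with
  | zero => simp
  | succ j ih =>
    rw [pow_succ', RingAut.mul_apply, ih, add_comm, iterateFrobenius_add_apply]
    simp

theorem selfDualRelations_iff [IsAlgClosed k] (g : ℕ) (a : ℕ → k) :
    SelfDualRelations p g a ↔ ∀ j, 1 ≤ j → j < g - 1 → j % 2 = g % 2 →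
      dualityForm g a (fun i => iterateFrobenius k p j (a i)) = 0 := by
  simp only [SelfDualRelations, frobeniusEquiv_pow_apply]
  rcases Nat.even_or_odd' g with ⟨n, rfl | rfl⟩
  · rw [if_pos (by simp)]
    refine forall_congr' fun j => forall_congr' fun h1 => forall_congr' fun h2 => ?_
    rw [Nat.even_iff, Nat.mul_mod_right]
    refine forall_congr' fun h3 => ?_
    obtain ⟨m, rfl⟩ : ∃ m, n = m + 1 := ⟨n - 1, by omega⟩
    rw [dualityForm_even, sum_Icc_succ_top (by omega), ← sub_eq_zero,
      show 2 * (m + 1) / 2 = m + 1 by omega, show 2 * (m + 1) + 1 - (m + 1) = m + 1 + 1 by omega,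
      show m + 1 - 1 = m by omega]
    refine Eq.congr ?_ rfl
    rw [sub_eq_add_neg]
    congr 1
    · exact sum_congr rfl fun i _ => by ring
    · ring
  · rw [if_neg (by simp)]
    refine forall_congr' fun j => forall_congr' fun h1 => forall_congr' fun h2 => ?_
    rw [Nat.odd_iff, show (2 * n + 1) % 2 = 1 by omega]
    refine forall_congr' fun h3 => ?_
    rw [dualityForm_odd, ← sub_eq_zero,
      show (2 * n + 1 - 1) / 2 = n by omega, show (2 * n + 1 + 1) / 2 = n + 1 by omega]
    refine Eq.congr ?_ rfl
    congr 1
    exact sum_congr rfl fun i _ => by ring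

end

section

open Polynomial

variable (p : ℕ) [Fact p.Prime] {k : Type*} [Field k] [CharP k p]

local notation "Φ" => iterateFrobenius k p

theorem finite_setOf_iterateFrobenius_eq_self {n : ℕ} (hn : 0 < n) :
    {x : k | Φ n x = x}.Finite := by
  have hp : 1 < p ^ n := Nat.one_lt_pow hn.ne' (Fact.out : p.Prime).one_lt
  have hne : (X ^ p ^ n - X : k[X]) ≠ 0 := FiniteField.X_pow_card_sub_X_ne_zero k hp
  refine (finite_setOfPred_isRoot hne).subset fun x hx => ?_
  simpa [sub_eq_zero, iterateFrobenius_def] using hx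

variable [IsAlgClosed k]

theorem exists_pow_add_mul_eq {N : ℕ} (hN : 1 < N) (s r : k) : ∃ x : k, x ^ N + s * x = r := by
  have hlt : (C s * X - C r : k[X]).degree < (N : ℕ) :=
    degree_linear_le.trans_lt (by exact_mod_cast hN) |>.trans_le' (by rw [sub_eq_add_neg, ← C_neg])
  have hdeg : (X ^ N + (C s * X - C r) : k[X]).degree ≠ 0 := by
    rw [degree_add_eq_left_of_degree_lt (by rwa [degree_X_pow]), degree_X_pow]
    exact_mod_cast (by omega : N ≠ 0)
  obtain ⟨x, hx⟩ := IsAlgClosed.exists_root _ hdeg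
  refine ⟨x, ?_⟩
  simp only [IsRoot.def, eval_add, eval_sub, eval_mul, eval_pow, eval_X, eval_C] at hx
  linear_combination hx

theorem exists_quadIndependent_even {n : ℕ} (hn : 0 < n) : ∃ a : ℕ → k,
    QuadIndependent p (2 * n) a ∧ ∀ j, 1 ≤ j → j < 2 * n - 1 → j % 2 = 2 * n % 2 →
      dualityForm (2 * n) a (fun i => Φ j (a i)) = 0 := by
  obtain ⟨x, y, hx, hy, hxy⟩ := exists_dual_families (p := p) (k := k) n hn
  have hyx : ∀ i ∈ Icc 1 n, ∀ l ∈ Icc 1 n,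
      ∑ s ∈ range n, Φ (2 * s) (y i) * Φ (2 * s) (x l) = if i = l then 1 else 0 := by
    intro i hi l hl
    rw [if_congr eq_comm rfl rfl, ← hxy l hl i hi]
    exact sum_congr rfl fun s _ => mul_comm _ _
  obtain ⟨z, hz⟩ := (finite_setOf_iterateFrobenius_eq_self p (k := k)
    (n := 2 * n) (by omega)).infinite_compl.nonempty
  simp only [Set.mem_compl_iff, Set.mem_ofPred_eq] at hz
  let a : ℕ → k := fun i => if i ≤ n then x i else z * y (2 * n + 1 - i)
  have ha1 : ∀ i ∈ Icc 1 n, a i = x i := fun i hi => if_pos (mem_Icc.1 hi).2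
  have ha2 : ∀ i ∈ Icc 1 n, a (2 * n + 1 - i) = z * y i := fun i hi => by
    rw [mem_Icc] at hi
    simp only [a]
    rw [if_neg (by omega), show 2 * n + 1 - (2 * n + 1 - i) = i by omega]
  refine ⟨a, ?_, ?_⟩
  · intro c hc h
    replace hc : ∀ i, Φ 2 (c i) = c i := hc
    have h1 : ∑ i ∈ Icc 1 n, c i * x i + z * ∑ i ∈ Icc 1 n, c (2 * n + 1 - i) * y i = 0 := by
      rw [← h, sum_Icc_even, mul_sum, ← sum_add_distrib]
      refine sum_congr rfl fun i hi => ?_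
      rw [ha1 i hi, ha2 i hi]
      ring
    have h2 := congrArg (Φ (2 * n)) h1
    simp only [map_add, map_mul, map_sum, map_zero, hx, hy,
      iterateFrobenius_mul_of_fixed (hc _)] at h2
    have h3 : ∑ i ∈ Icc 1 n, c (2 * n + 1 - i) * y i = 0 := by
      have : (Φ (2 * n) z - z) * ∑ i ∈ Icc 1 n, c (2 * n + 1 - i) * y i = 0 := by
        linear_combination h2 - h1
      exact (mul_eq_zero.1 this).resolve_left (sub_ne_zero.2 hz)
    rw [h3, mul_zero, add_zero] at h1
    have h4 := eq_zero_of_sum_dual hxy hc h1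
    have h5 := eq_zero_of_sum_dual hyx (fun i => hc (2 * n + 1 - i)) h3
    intro i hi
    rw [mem_Icc] at hi
    rcases le_or_gt i n with hin | hin
    · exact h4 i (mem_Icc.2 ⟨hi.1, hin⟩)
    · have := h5 (2 * n + 1 - i) (mem_Icc.2 (by omega))
      rwa [show 2 * n + 1 - (2 * n + 1 - i) = i by omega] at this
  · intro j h1 h2 h3
    obtain ⟨s, rfl⟩ : ∃ s, j = 2 * s := ⟨j / 2, by omega⟩
    have e1 := sum_frobenius_dual hyx (s := 0) (t := s) (by omega) (by omega)
    have e2 := sum_frobenius_dual hxy (s := 0) (t := s) (by omega) (by omega)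
    rw [if_neg (by omega)] at e1 e2
    calc _ = -z * ∑ i ∈ Icc 1 n, Φ (2 * 0) (y i) * Φ (2 * s) (x i)
        + Φ (2 * s) z * ∑ i ∈ Icc 1 n, Φ (2 * 0) (x i) * Φ (2 * s) (y i) := by
          rw [dualityForm_even, mul_sum, mul_sum, ← sum_add_distrib]
          refine sum_congr rfl fun i hi => ?_
          simp only [ha1 i hi, ha2 i hi, map_mul, mul_zero, iterateFrobenius_zero_apply]
          ring
      _ = 0 := by rw [e1, e2, mul_zero, mul_zero, add_zero]

theorem exists_frobenius_generic {n : ℕ} (hn : 0 < n) : ∃ z : k, Φ (2 * n) z ≠ z ∧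
    ∀ e w, Φ (2 * n) e = e → Φ (2 * n) w = w →
      e + ∑ t ∈ range n, Φ (2 * t) w * Φ (2 * t + 1) z = 0 → w = 0 := by
  have hE := finite_setOf_iterateFrobenius_eq_self p (k := k) (n := 2 * n) (by omega)
  let P : k → k → k[X] := fun e w => C e + ∑ t ∈ range n, C (Φ (2 * t) w) * X ^ p ^ (2 * t + 1)
  have hp : 1 < p := (Fact.out : p.Prime).one_lt
  have hcoeff : ∀ e w, (P e w).coeff p = w := by
    intro e w
    simp only [P, coeff_add, finsetSum_coeff, coeff_C_mul, coeff_X_pow,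
      coeff_C_of_ne_zero (by omega : p ≠ 0), zero_add]
    rw [sum_eq_single_of_mem 0 (mem_range.2 hn)]
    · simp
    · intro t _ ht
      rw [if_neg, mul_zero]
      intro h
      have := Nat.pow_right_injective hp ((pow_one p).trans h)
      omega
  have hbad : (⋃ e ∈ {x : k | Φ (2 * n) x = x}, ⋃ w ∈ {x : k | Φ (2 * n) x = x} \ {0},
      {z | (P e w).IsRoot z}).Finite := by
    refine hE.biUnion fun e _ => (hE.subset Set.sdiff_subset).biUnion fun w hw => ?_
    refine finite_setOfPred_isRoot fun h => hw.2 ?_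
    rw [Set.mem_singleton_iff, ← hcoeff e w, h, coeff_zero]
  obtain ⟨z, hz⟩ := (hE.union hbad).infinite_compl.nonempty
  simp only [Set.mem_compl_iff, Set.mem_union, Set.mem_iUnion, not_or, not_exists] at hz
  refine ⟨z, hz.1, fun e w he hw h => ?_⟩
  by_contra hw0
  refine hz.2 e he w ⟨hw, hw0⟩ ?_
  simpa [P, eval_finsetSum, iterateFrobenius_def] using h

theorem exists_frobenius_reflect_solution (n : ℕ) (R : ℕ → k) : ∃ μ : ℕ → k,
    ∀ r < n, μ r + Φ (2 * r + 1) (μ (n - 1 - r)) = R r := by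
  have hp : 1 < p := (Fact.out : p.Prime).one_lt
  have hν : ∀ r, ∃ ν : k, (r < n - 1 - r →
      Φ (2 * n) ν - ν = Φ (2 * r + 1) (R (n - 1 - r)) - R r) ∧
      (r = n - 1 - r → ν + Φ (2 * r + 1) ν = R r) := by
    intro r
    by_cases hr : r = n - 1 - r
    · obtain ⟨ν, h⟩ := exists_pow_add_mul_eq (Nat.one_lt_pow (n := 2 * r + 1) (by omega) hp)
        (1 : k) (R r)
      refine ⟨ν, fun h' => by omega, fun _ => ?_⟩
      rw [iterateFrobenius_def]
      linear_combination h
    · by_cases hn : n = 0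
      · exact ⟨0, fun h' => by omega, fun h' => absurd h' hr⟩
      obtain ⟨ν, h⟩ := exists_pow_add_mul_eq (Nat.one_lt_pow (n := 2 * n) (by omega) hp)
        (-1 : k) (Φ (2 * r + 1) (R (n - 1 - r)) - R r)
      refine ⟨ν, fun _ => ?_, fun h' => absurd h' hr⟩
      rw [iterateFrobenius_def]
      linear_combination h
  choose ν hν1 hν2 using hν
  refine ⟨fun r => if r ≤ n - 1 - r then ν r else R r - Φ (2 * r + 1) (ν (n - 1 - r)), ?_⟩
  intro r hr
  have hrr : n - 1 - (n - 1 - r) = r := by omega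
  rcases lt_trichotomy r (n - 1 - r) with h | h | h
  · have h' := hν1 r h
    simp only [hrr]
    rw [if_pos h.le, if_neg h.not_ge, map_sub, iterateFrobenius_iterate,
      show 2 * r + 1 + (2 * (n - 1 - r) + 1) = 2 * n by omega]
    linear_combination -h'
  · simp only [← h]
    rw [if_pos le_rfl, hν2 r h]
  · simp only [hrr]
    rw [if_neg h.not_ge, if_pos h.le]
    ring

end

section

variable (p : ℕ) [Fact p.Prime] {k : Type*} [Field k] [CharP k p] [IsAlgClosed k]

local notation "Φ" => iterateFrobenius k p

theorem exists_quadIndependent_odd {n : ℕ} (hn : 0 < n) : ∃ a : ℕ → k,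
    QuadIndependent p (2 * n + 1) a ∧
      ∀ j, 1 ≤ j → j < 2 * n + 1 - 1 → j % 2 = (2 * n + 1) % 2 →
        dualityForm (2 * n + 1) a (fun i => Φ j (a i)) = 0 := by
  obtain ⟨x, y, hx, hy, hxy⟩ := exists_dual_families (p := p) (k := k) n hn
  have hyx : ∀ i ∈ Icc 1 n, ∀ l ∈ Icc 1 n,
      ∑ s ∈ range n, Φ (2 * s) (y i) * Φ (2 * s) (x l) = if i = l then 1 else 0 := by
    intro i hi l hl
    rw [if_congr eq_comm rfl rfl, ← hxy l hl i hi]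
    exact sum_congr rfl fun s _ => mul_comm _ _
  obtain ⟨z, hz, hgen⟩ := exists_frobenius_generic p (k := k) hn
  set ε : k := (-1) ^ (n + 1) with hε
  have hεΦ : ∀ s, Φ s ε = ε := fun s => by simp [ε]
  have hε2 : ε * ε = 1 := by rw [hε, ← mul_pow]; simp
  obtain ⟨μ, hμ⟩ := exists_frobenius_reflect_solution p n fun r => ε * (z * Φ (2 * r + 1) z)
  have hμ2 : ∀ r < n, Φ (2 * n) (μ r) - μ r = ε * Φ (2 * r + 1) z * (Φ (2 * n) z - z) := by
    intro r hr
    have e1 := hμ r hr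
    have e2 := congrArg (Φ (2 * r + 1)) (hμ (n - 1 - r) (by omega))
    simp only [show n - 1 - (n - 1 - r) = r by omega, map_add, map_mul, hεΦ,
      iterateFrobenius_iterate, show 2 * r + 1 + (2 * (n - 1 - r) + 1) = 2 * n by omega] at e2
    linear_combination e2 - e1
  let b : ℕ → k := fun i => ∑ t ∈ range n, μ t * Φ (2 * t + 1) (y i)
  let a : ℕ → k := fun i => if i ≤ n then x i else if i = n + 1 then z else b (2 * n + 1 + 1 - i)
  have ha1 : ∀ i ∈ Icc 1 n, a i = x i := fun i hi => if_pos (mem_Icc.1 hi).2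
  have ha2 : ∀ i ∈ Icc 1 n, a (2 * n + 1 + 1 - i) = b i := fun i hi => by
    rw [mem_Icc] at hi
    simp only [a]
    rw [if_neg (by omega), if_neg (by omega),
      show 2 * n + 1 + 1 - (2 * n + 1 + 1 - i) = i by omega]
  have ha3 : a (n + 1) = z := by simp [a]
  refine ⟨a, ?_, ?_⟩
  · intro c hc h
    replace hc : ∀ i, Φ 2 (c i) = c i := hc
    let d : ℕ → k := fun i => c (2 * n + 1 + 1 - i)
    have h1 : ∑ i ∈ Icc 1 n, c i * x i + c (n + 1) * z + ∑ i ∈ Icc 1 n, d i * b i = 0 := by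
      rw [← h, sum_Icc_odd, ha3, add_right_comm, ← sum_add_distrib]
      congr 1
      exact sum_congr rfl fun i hi => by rw [ha1 i hi, ha2 i hi]
    let w : k := ∑ i ∈ Icc 1 n, d i * Φ 1 (y i)
    have hdb : ∑ i ∈ Icc 1 n, d i * b i = ∑ t ∈ range n, μ t * Φ (2 * t) w := by
      simp only [b, w, mul_sum, map_sum, map_mul]
      rw [sum_comm]
      refine sum_congr rfl fun t _ => sum_congr rfl fun i _ => ?_
      rw [iterateFrobenius_mul_of_fixed (hc _), iterateFrobenius_iterate]
      ring
    have hw : Φ (2 * n) w = w := by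
      simp only [w, map_sum, map_mul]
      refine sum_congr rfl fun i _ => ?_
      rw [iterateFrobenius_mul_of_fixed (hc _), iterateFrobenius_fixed (hy i)]
    have h2 := congrArg (Φ (2 * n)) h1
    simp only [hdb] at h1 h2
    simp only [map_add, map_mul, map_sum, map_zero, hx,
      iterateFrobenius_mul_of_fixed (hc _), iterateFrobenius_fixed hw] at h2
    have h3 : ∑ t ∈ range n, Φ (2 * n) (μ t) * Φ (2 * t) w - ∑ t ∈ range n, μ t * Φ (2 * t) w
        = (Φ (2 * n) z - z) * (ε * ∑ t ∈ range n, Φ (2 * t) w * Φ (2 * t + 1) z) := by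
      rw [← sum_sub_distrib, mul_sum, mul_sum]
      refine sum_congr rfl fun t ht => ?_
      linear_combination Φ (2 * t) w * hμ2 t (mem_range.1 ht)
    have h4 : ε * c (n + 1) + ∑ t ∈ range n, Φ (2 * t) w * Φ (2 * t + 1) z = 0 := by
      refine (mul_eq_zero.1 ?_).resolve_left (sub_ne_zero.2 hz)
      linear_combination ε * (h2 - h1 - h3) -
        (Φ (2 * n) z - z) * (∑ t ∈ range n, Φ (2 * t) w * Φ (2 * t + 1) z) * hε2
    have hw0 : w = 0 := hgen (ε * c (n + 1)) w
      (by rw [map_mul, hεΦ, iterateFrobenius_mul_of_fixed (hc _)]) hw h4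
    have hd : ∀ i ∈ Icc 1 n, d i = 0 := by
      have hz1 : ∑ i ∈ Icc 1 n, Φ 1 (d i) * y i = 0 := by
        apply (iterateFrobenius k p 1).injective
        rw [map_zero, ← hw0, map_sum]
        refine sum_congr rfl fun i _ => ?_
        rw [map_mul, iterateFrobenius_iterate, hc]
      intro i hi
      have := eq_zero_of_sum_dual hyx (fun i => iterateFrobenius_fixed (hc _) 1) hz1 i hi
      exact (map_eq_zero _).1 this
    have hm : c (n + 1) = 0 := by
      have hε0 : ε ≠ 0 := left_ne_zero_of_mul_eq_one hε2
      have : ε * c (n + 1) = 0 := by simpa [hw0] using h4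
      exact (mul_eq_zero.1 this).resolve_left hε0
    have h5 : ∑ i ∈ Icc 1 n, c i * x i = 0 := by simpa [hm, hw0] using h1
    have h6 := eq_zero_of_sum_dual hxy hc h5
    intro i hi
    rw [mem_Icc] at hi
    rcases lt_trichotomy i (n + 1) with hin | rfl | hin
    · exact h6 i (mem_Icc.2 (by omega))
    · exact hm
    · have := hd (2 * n + 1 + 1 - i) (mem_Icc.2 (by omega))
      simp only [d] at this
      rwa [show 2 * n + 1 + 1 - (2 * n + 1 + 1 - i) = i by omega] at this
  · intro j h1 h2 h3
    obtain ⟨r, rfl⟩ : ∃ r, j = 2 * r + 1 := ⟨j / 2, by omega⟩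
    have hr : r < n := by omega
    have e1 : ∑ i ∈ Icc 1 n, b i * Φ (2 * r + 1) (x i) = μ r := by
      calc _ = ∑ t ∈ range n, μ t *
            Φ 1 (∑ i ∈ Icc 1 n, Φ (2 * t) (y i) * Φ (2 * r) (x i)) := by
            simp only [b, sum_mul, mul_sum, map_sum, map_mul, iterateFrobenius_iterate]
            rw [sum_comm]
            refine sum_congr rfl fun t _ => sum_congr rfl fun i _ => ?_
            rw [add_comm 1, add_comm 1]
            ring
        _ = ∑ t ∈ range n, if t = r then μ t else 0 := by
            refine sum_congr rfl fun t ht => ?_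
            rw [sum_frobenius_dual hyx (mem_range.1 ht) hr]
            split_ifs <;> simp
        _ = μ r := by simp [hr]
    have e2 : ∑ i ∈ Icc 1 n, x i * Φ (2 * r + 1) (b i) = Φ (2 * r + 1) (μ (n - 1 - r)) := by
      calc _ = ∑ t ∈ range n, Φ (2 * r + 1) (μ t) *
            ∑ i ∈ Icc 1 n, Φ (2 * 0) (x i) * Φ (2 * ((t + r + 1) % n)) (y i) := by
            simp only [b, mul_sum, map_sum, map_mul, iterateFrobenius_iterate]
            rw [sum_comm]
            refine sum_congr rfl fun t _ => sum_congr rfl fun i _ => ?_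
            have : Φ (2 * r + 1 + (2 * t + 1)) (y i) = Φ (2 * ((t + r + 1) % n)) (y i) := by
              conv_rhs => rw [← iterateFrobenius_mul_of_fixed (hy i) ((t + r + 1) / n),
                iterateFrobenius_iterate]
              congr 2
              have := Nat.mod_add_div (t + r + 1) n
              rw [mul_assoc, ← mul_add, this]
              ring
            rw [this, mul_zero, iterateFrobenius_zero_apply]
            ring
        _ = ∑ t ∈ range n, if t = n - 1 - r then Φ (2 * r + 1) (μ t) else 0 := by
            refine sum_congr rfl fun t ht => ?_
            rw [mem_range] at ht
            rw [sum_frobenius_dual hxy hn (Nat.mod_lt _ hn)]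
            rcases lt_trichotomy t (n - 1 - r) with h | h | h
            · rw [Nat.mod_eq_of_lt (by omega), if_neg (by omega), if_neg (by omega), mul_zero]
            · rw [show t + r + 1 = n by omega, Nat.mod_self, if_pos rfl, if_pos h, mul_one]
            · rw [Nat.mod_eq_sub_mod (by omega), Nat.mod_eq_of_lt (by omega), if_neg (by omega),
                if_neg (by omega), mul_zero]
        _ = Φ (2 * r + 1) (μ (n - 1 - r)) := by
            rw [sum_ite_eq', if_pos (mem_range.2 (by omega))]
    have e3 : ∑ i ∈ Icc 1 n, (a (2 * n + 1 + 1 - i) * Φ (2 * r + 1) (a i) +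
          a i * Φ (2 * r + 1) (a (2 * n + 1 + 1 - i))) =
        μ r + Φ (2 * r + 1) (μ (n - 1 - r)) := by
      rw [← e1, ← e2, ← sum_add_distrib]
      exact sum_congr rfl fun i hi => by rw [ha1 i hi, ha2 i hi]
    rw [dualityForm_odd, e3, hμ r hr, ha3]
    ring

theorem exists_quadIndependent_selfDualRelations {g : ℕ} (hg : 2 ≤ g) :
    ∃ a : ℕ → k, QuadIndependent p g a ∧ SelfDualRelations p g a := by
  simp only [selfDualRelations_iff]
  rcases Nat.even_or_odd' g with ⟨n, rfl | rfl⟩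
  · exact exists_quadIndependent_even p (by omega)
  · exact exists_quadIndependent_odd p (by omega)

end

section

variable (p : ℕ) [Fact p.Prime] {k : Type*} [Field k] [CharP k p]

local notation "Φ" => iterateFrobenius k p

theorem iterateFrobenius_congr_mod_two {c : k} (hc : Φ 2 c = c) {i j : ℕ} (hij : i % 2 = j % 2) :
    Φ i c = Φ j c := by
  have key : ∀ m, Φ m c = Φ (m % 2) c := fun m => by
    conv_lhs => rw [← Nat.mod_add_div m 2, ← iterateFrobenius_iterate,
      iterateFrobenius_mul_of_fixed hc]
  rw [key i, key j, hij]

theorem QuadIndependent.eq_zero_of_frobenius_combination {g : ℕ} (hg : 4 ≤ g) {b : ℕ → k}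
    (hb : QuadIndependent p g b) {u v : ℕ → k} (hu : ∀ i, Φ 2 (u i) = u i)
    (hv : ∀ i, Φ 2 (v i) = v i) {P Q X Y : k}
    (h : ∀ i ∈ Icc 1 g, P * b i + Q * Φ 2 (b i) = X * u i + Y * v i) : P = 0 ∧ Q = 0 := by
  let F : Subfield k := RingHom.eqLocusField (Φ 2) (RingHom.id k)
  let L : (Icc 1 g → F) →ₗ[F] (Fin 2 → F) := Matrix.mulVecLin
    (Matrix.of ![fun i : Icc 1 g => (⟨u i, hu i⟩ : F), fun i => ⟨v i, hv i⟩])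
  have hker : 1 < Module.finrank F (LinearMap.ker L) := by
    have h1 := L.finrank_range_add_finrank_ker
    have h2 := (LinearMap.range L).finrank_le
    simp only [Module.finrank_fintype_fun_eq_card, Fintype.card_fin, Fintype.card_coe,
      Nat.card_Icc] at h1 h2
    omega
  have : Nontrivial (LinearMap.ker L) := Module.nontrivial_of_finrank_pos (R := F) (by omega)
  obtain ⟨d, hd⟩ := exists_ne (0 : LinearMap.ker L)
  obtain ⟨d', hdd'⟩ := exists_linearIndependent_pair_of_one_lt_finrank hker hd
  have hinj : ∀ e : Icc 1 g → F, ∑ i, (e i : k) * b i = 0 → e = 0 := by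
    intro e he
    let c : ℕ → k := fun i => if hi : i ∈ Icc 1 g then e ⟨i, hi⟩ else 0
    have hc : ∀ i, c i ^ p ^ 2 = c i := by
      intro i
      simp only [c]
      split_ifs with hi
      · exact (e ⟨i, hi⟩).2
      · exact map_zero (Φ 2)
    have := hb c hc (by
      rw [← sum_coe_sort, ← he]
      exact sum_congr rfl fun i _ => by simp only [c, dif_pos i.2])
    funext i
    have := this i i.2
    simp only [c, dif_pos i.2] at this
    exact Subtype.ext this
  have hrel : ∀ e ∈ LinearMap.ker L,
      P * ∑ i, (e i : k) * b i + Q * Φ 2 (∑ i, (e i : k) * b i) = 0 := by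
    intro e he
    have he0 : ∑ i, (e i : k) * u i = 0 := by
      have := congrArg (Subtype.val) (congrFun (LinearMap.mem_ker.1 he) 0)
      simpa [L, Matrix.mulVec, dotProduct, mul_comm] using this
    have he1 : ∑ i, (e i : k) * v i = 0 := by
      have := congrArg (Subtype.val) (congrFun (LinearMap.mem_ker.1 he) 1)
      simpa [L, Matrix.mulVec, dotProduct, mul_comm] using this
    calc _ = X * ∑ i, (e i : k) * u i + Y * ∑ i, (e i : k) * v i := by
          simp only [map_sum, map_mul, mul_sum, ← sum_add_distrib]
          refine sum_congr rfl fun i _ => ?_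
          have hei : Φ 2 (e i : k) = e i := (e i).2
          rw [hei]
          linear_combination (e i : k) * h i i.2
      _ = 0 := by rw [he0, he1, mul_zero, mul_zero, add_zero]
  set V := ∑ i, (d.1 i : k) * b i with hV
  set W := ∑ i, (d'.1 i : k) * b i with hW
  have hV0 : V ≠ 0 := fun h0 => hd (Subtype.ext (hinj _ h0))
  have rV : P * V + Q * Φ 2 V = 0 := hrel d d.2
  have rW : P * W + Q * Φ 2 W = 0 := hrel d' d'.2
  by_cases hQ : Q = 0
  · subst hQ
    rw [zero_mul, add_zero] at rV
    exact ⟨(mul_eq_zero.1 rV).resolve_right hV0, rfl⟩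
  exfalso
  have hΦV : Φ 2 V ≠ 0 := (map_ne_zero _).2 hV0
  have hVW : Φ 2 W * V = W * Φ 2 V := by
    apply mul_left_cancel₀ hQ
    linear_combination V * rW - W * rV
  have hr : Φ 2 (W / V) = W / V := by
    rw [map_div₀, div_eq_div_iff hΦV hV0, hVW]
  let r : F := ⟨W / V, hr⟩
  have hdr : (d'.1 - r • d.1) = 0 := by
    apply hinj
    have : ∀ i, (((d'.1 - r • d.1) i : F) : k) * b i
        = (d'.1 i : k) * b i - W / V * ((d.1 i : k) * b i) := fun i => by
      simp [r]
      ring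
    rw [sum_congr rfl fun i _ => this i, sum_sub_distrib, ← mul_sum, ← hV, ← hW,
      div_mul_cancel₀ _ hV0, sub_self]
  have hpair := LinearIndependent.pair_iff.1 hdd' (-r) 1 (by
    apply Subtype.ext
    simpa [sub_eq_add_neg, add_comm] using hdr)
  exact one_ne_zero hpair.2

theorem QuadIndependent.transvection {g : ℕ} {a : ℕ → k} (ha : QuadIndependent p g a)
    {v : ℕ → k} (hv : ∀ i, Φ 2 (v i) = v i)
    (hiso : dualityForm g v (fun i => Φ (g % 2) (v i)) = 0) {c : k} (hc : Φ 2 c = c) :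
    QuadIndependent p g
      (fun i => a i + c * dualityForm g a (fun i => Φ (g % 2) (v i)) * v i) := by
  intro d hd h
  set φ := dualityForm g a (fun i => Φ (g % 2) (v i)) with hφ
  obtain ⟨D, hDdef⟩ : ∃ D, D = ∑ i ∈ Icc 1 g, d i * v i := ⟨_, rfl⟩
  let f : ℕ → k := fun i => dualitySign k g (g + 1 - i) * Φ (g % 2) (v (g + 1 - i))
  have hD : Φ 2 D = D := by
    simp only [hDdef, map_sum, map_mul, hv]
    exact sum_congr rfl fun i _ => by rw [iterateFrobenius_def, hd]
  have hf : ∀ i, Φ 2 (f i) = f i := fun i => by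
    simp only [f, map_mul, map_dualitySign, iterateFrobenius_fixed (hv _)]
  have h1 : ∑ i ∈ Icc 1 g, (d i + c * D * f i) * a i = 0 := by
    rw [← h]
    simp only [add_mul, mul_add, sum_add_distrib]
    congr 1
    rw [hφ, dualityForm_eq_sum]
    simp only [hDdef, mul_sum, sum_mul]
    rw [sum_comm]
    exact sum_congr rfl fun i _ => sum_congr rfl fun l _ => by ring
  have h2 := ha _ (fun i => by
    rw [← iterateFrobenius_def, map_add, map_mul, map_mul, hc, hD, hf, iterateFrobenius_def,
      hd]) h1
  have hD0 : D = 0 := by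
    calc D = ∑ i ∈ Icc 1 g, (d i + c * D * f i) * v i - c * D * ∑ i ∈ Icc 1 g, f i * v i := by
          conv_lhs => rw [hDdef]
          rw [mul_sum, ← sum_sub_distrib]
          exact sum_congr rfl fun i _ => by ring
      _ = 0 := by
          rw [(dualityForm_eq_sum g v _).symm.trans hiso, mul_zero, sub_zero]
          exact sum_eq_zero fun i hi => by rw [h2 i hi, zero_mul]
  intro i hi
  simpa [hD0] using h2 i hi

theorem SelfDualRelations.transvection [IsAlgClosed k] {g : ℕ} {a : ℕ → k}
    (ha : SelfDualRelations p g a) {v : ℕ → k} (hv : ∀ i, Φ 2 (v i) = v i)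
    (hiso : dualityForm g v (fun i => Φ (g % 2) (v i)) = 0) {c : k} (hc : Φ 2 c = c)
    (hc' : (if Even g then -1 else 1) * Φ (g % 2) c = -c) :
    SelfDualRelations p g
      (fun i => a i + c * dualityForm g a (fun i => Φ (g % 2) (v i)) * v i) := by
  rw [selfDualRelations_iff] at *
  intro j h1 h2 h3
  set φ := dualityForm g a (fun i => Φ (g % 2) (v i)) with hφ
  have e1 : (fun i => Φ j (a i + c * φ * v i)) =
      fun i => Φ j (a i) + Φ (g % 2) c * Φ j φ * Φ (g % 2) (v i) := by
    funext i
    rw [map_add, map_mul, map_mul,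
      iterateFrobenius_congr_mod_two p hc (h3.trans (Nat.mod_mod g 2).symm),
      iterateFrobenius_congr_mod_two p (hv i) (h3.trans (Nat.mod_mod g 2).symm)]
  have e2 : Φ j φ = (if Even g then -1 else 1) * dualityForm g v (fun i => Φ j (a i)) := by
    rw [hφ, map_dualityForm, ← dualityForm_swap]
    congr 1
    funext i
    rw [iterateFrobenius_iterate, iterateFrobenius_congr_mod_two p (hv i) (j := 0) (by omega),
      iterateFrobenius_zero_apply]
  rw [e1, dualityForm_add_smul_left, dualityForm_add_smul_right, dualityForm_add_smul_right,
    ha j h1 h2 h3, hiso, ← hφ, e2]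
  linear_combination φ * dualityForm g v (fun i => Φ j (a i)) * hc'

end

section

variable (p : ℕ) [Fact p.Prime] {k : Type*} [Field k] [CharP k p]

local notation "Φ" => iterateFrobenius k p

theorem QuadIndependent.dualityForm_ne_zero {g : ℕ} {a : ℕ → k} (ha : QuadIndependent p g a)
    {w : ℕ → k} (hw : ∀ i, Φ 2 (w i) = w i) {l : ℕ} (hl : l ∈ Icc 1 g) (hwl : w l ≠ 0) :
    dualityForm g a w ≠ 0 := by
  intro h
  rw [dualityForm_eq_sum] at h
  rw [mem_Icc] at hl
  have := ha _ (fun i => by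
    rw [← iterateFrobenius_def, map_mul, map_dualitySign, hw]) h (g + 1 - l)
    (mem_Icc.2 (by omega))
  rw [show g + 1 - (g + 1 - l) = l by omega] at this
  exact (mul_ne_zero (dualitySign_ne_zero g l) hwl) this

theorem iterateFrobenius_two_of_eq_neg {c : k} (hc : Φ 1 c = -c) : Φ 2 c = c := by
  rw [← iterateFrobenius_iterate 1 1, hc, map_neg, hc, neg_neg]

variable [IsAlgClosed k]

theorem exists_iterateFrobenius_one_eq_neg : ∃ c : k, c ≠ 0 ∧ Φ 1 c = -c := by
  have hp := (Fact.out : p.Prime).two_le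
  obtain ⟨c, hc⟩ := IsAlgClosed.exists_pow_nat_eq (-1 : k) (n := p - 1) (by omega)
  refine ⟨c, ?_, ?_⟩
  · rintro rfl
    rw [zero_pow (by omega)] at hc
    exact one_ne_zero (neg_eq_zero.1 hc.symm)
  · rw [iterateFrobenius_def, pow_one, show p = p - 1 + 1 by omega, pow_succ, hc]
    ring

theorem exists_add_iterateFrobenius_one_eq {r : k} (hr : Φ 1 r = r) :
    ∃ y : k, y + Φ 1 y = r ∧ Φ 2 y = y := by
  obtain ⟨y, hy⟩ := exists_pow_add_mul_eq (Fact.out : p.Prime).one_lt 1 r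
  have h1 : Φ 1 y = r - y := by
    rw [iterateFrobenius_def, pow_one, ← hy]
    ring
  refine ⟨y, by rw [h1]; ring, ?_⟩
  rw [← iterateFrobenius_iterate 1 1, h1, map_sub, hr, h1]
  ring

theorem exists_iterateFrobenius_two_fixed_ne : ∃ c : k, Φ 2 c = c ∧ Φ 1 c ≠ c := by
  obtain ⟨y, hy, hy2⟩ := exists_add_iterateFrobenius_one_eq (p := p) (map_one (Φ 1))
  by_cases h : Φ 1 y = y
  · obtain ⟨c, hc0, hc⟩ := exists_iterateFrobenius_one_eq_neg p (k := k)
    refine ⟨c, iterateFrobenius_two_of_eq_neg p hc, fun h' => ?_⟩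
    rw [hc] at h'
    have h2 : (2 : k) = 0 :=
      (mul_eq_zero.1 (by linear_combination -h' : (2 : k) * c = 0)).resolve_right hc0
    rw [h] at hy
    exact one_ne_zero (by linear_combination -hy + y * h2 : (1 : k) = 0)
  · exact ⟨y, hy2, h⟩

/-- If `σ (δ a)` always lies in the span of `a` and `σ² a`, then the conjugate of `δ` has every
isotropic vector as an eigenvector, up to conjugation. -/
theorem exists_eq_smul_of_isotropic {g : ℕ} (hg : 4 ≤ g) {δ : ℕ → ℕ → k}
    (hspan : ∀ a : ℕ → k, QuadIndependent p g a → SelfDualRelations p g a →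
      ∃ r s : k, ∀ i ∈ Icc 1 g, Φ 1 (∑ l ∈ Icc 1 g, δ i l * a l) = r * a i + s * Φ 2 (a i))
    (hδ : ∀ i l, Φ 2 (δ i l) = δ i l)
    {v : ℕ → k} (hv : ∀ i, Φ 2 (v i) = v i)
    (hiso : dualityForm g v (fun i => Φ (g % 2) (v i)) = 0)
    {l : ℕ} (hl : l ∈ Icc 1 g) (hvl : v l ≠ 0) :
    ∃ s : k, ∀ i ∈ Icc 1 g, ∑ l ∈ Icc 1 g, Φ 1 (δ i l) * Φ 1 (v l) = s * v i := by
  obtain ⟨a, ha, ha'⟩ := exists_quadIndependent_selfDualRelations (k := k) p (g := g) (by omega)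
  obtain ⟨c, hc0, hc, hc'⟩ : ∃ c : k, c ≠ 0 ∧ Φ 2 c = c ∧
      (if Even g then -1 else 1) * Φ (g % 2) c = -c := by
    split_ifs with h
    · exact ⟨1, one_ne_zero, map_one _, by rw [map_one, mul_one]⟩
    · obtain ⟨c, hc0, hc⟩ := exists_iterateFrobenius_one_eq_neg p (k := k)
      refine ⟨c, hc0, iterateFrobenius_two_of_eq_neg p hc, ?_⟩
      rw [Nat.not_even_iff.1 h, hc, one_mul]
  set φ := dualityForm g a (fun i => Φ (g % 2) (v i)) with hφ
  have hφ0 : φ ≠ 0 := ha.dualityForm_ne_zero p (w := fun i => Φ (g % 2) (v i))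
    (fun i => iterateFrobenius_fixed (hv i) _) hl ((map_ne_zero _).2 hvl)
  obtain ⟨r, s, hrs⟩ := hspan a ha ha'
  have hb := ha.transvection p hv hiso hc
  obtain ⟨r', s', hrs'⟩ := hspan _ hb (ha'.transvection p hv hiso hc hc')
  rw [← hφ] at hb hrs'
  have hcφ : Φ 1 (c * φ) ≠ 0 := (map_ne_zero _).2 (mul_ne_zero hc0 hφ0)
  have hexp : ∀ i, Φ 1 (∑ l ∈ Icc 1 g, δ i l * (a l + c * φ * v l)) =
      Φ 1 (∑ l ∈ Icc 1 g, δ i l * a l) +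
        Φ 1 (c * φ) * ∑ l ∈ Icc 1 g, Φ 1 (δ i l) * Φ 1 (v l) := by
    intro i
    simp only [← map_mul, ← map_sum, ← map_add]
    rw [mul_sum, ← sum_add_distrib]
    congr 1
    exact sum_congr rfl fun l _ => by ring
  have key : ∀ i ∈ Icc 1 g, (r' - r) * (a i + c * φ * v i) +
      (s' - s) * Φ 2 (a i + c * φ * v i) =
      Φ 1 (c * φ) * (∑ l ∈ Icc 1 g, Φ 1 (δ i l) * Φ 1 (v l)) +
        -(r * (c * φ) + s * Φ 2 (c * φ)) * v i := by
    intro i hi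
    have h1 := hrs i hi
    have h2 := hrs' i hi
    rw [hexp] at h2
    have h3 : Φ 2 (a i + c * φ * v i) = Φ 2 (a i) + Φ 2 (c * φ) * v i := by
      rw [map_add, map_mul _ (c * φ), hv]
    rw [h3] at h2 ⊢
    linear_combination h1 - h2
  obtain ⟨h1, h2⟩ := hb.eq_zero_of_frobenius_combination p hg (fun i => by
    rw [map_sum]
    exact sum_congr rfl fun l _ => by
      rw [map_mul, iterateFrobenius_fixed (hδ i l), iterateFrobenius_fixed (hv l)]) hv key
  refine ⟨(r * (c * φ) + s * Φ 2 (c * φ)) / Φ 1 (c * φ), fun i hi => ?_⟩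
  have := key i hi
  rw [h1, h2] at this
  rw [div_mul_eq_mul_div, eq_div_iff hcφ]
  linear_combination -this

end

section

variable (p : ℕ) [Fact p.Prime] {k : Type*} [Field k] [CharP k p]

local notation "Φ" => iterateFrobenius k p

/-- Every isotropic vector with entries in `𝔽_{p²}` is mapped by `D ∘ σ` to a multiple of itself. -/
def IsotropicEigen (g : ℕ) (D : ℕ → ℕ → k) : Prop :=
  ∀ v : ℕ → k, (∀ i, Φ 2 (v i) = v i) → dualityForm g v (fun i => Φ (g % 2) (v i)) = 0 →
    (∃ l ∈ Icc 1 g, v l ≠ 0) →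
    ∃ s : k, ∀ i ∈ Icc 1 g, ∑ l ∈ Icc 1 g, D i l * Φ 1 (v l) = s * v i

variable {p} {g : ℕ} {D : ℕ → ℕ → k}

theorem IsotropicEigen.exists_eq_mul_pair (h : IsotropicEigen p g D) {t l : ℕ}
    (ht : t ∈ Icc 1 g) (hl : l ∈ Icc 1 g) (htl : t ≠ l) (htt : g + 1 ≠ 2 * t)
    (hll : g + 1 ≠ 2 * l) (htl' : g + 1 ≠ t + l) {c : k} (hc : Φ 2 c = c) :
    ∃ s : k, D t t + D t l * Φ 1 c = s ∧ D l t + D l l * Φ 1 c = s * c ∧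
      ∀ i ∈ Icc 1 g, i ≠ t → i ≠ l → D i t + D i l * Φ 1 c = 0 := by
  obtain ⟨s, hs⟩ := h (fun i => (if i = t then 1 else 0) + if i = l then c else 0)
    (fun i => by split_ifs <;> simp [hc])
    (sum_eq_zero fun i hi => by
      rw [mem_Icc] at hi ht hl
      beta_reduce
      by_cases h1 : i = t ∨ i = l
      · rw [if_neg (by omega), if_neg (by omega)]
        simp
      · rw [not_or] at h1
        rw [if_neg h1.1, if_neg h1.2]
        simp)
    ⟨t, ht, by simp [htl]⟩
  have hsum : ∀ i, ∑ x ∈ Icc 1 g,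
      D i x * Φ 1 ((if x = t then 1 else 0) + if x = l then c else 0) =
      D i t + D i l * Φ 1 c := by
    intro i
    simp only [map_add, apply_ite (Φ 1), map_one, map_zero, mul_add, sum_add_distrib, mul_ite,
      mul_one, mul_zero, sum_ite_eq', if_pos ht, if_pos hl]
  simp only [hsum] at hs
  refine ⟨s, ?_, ?_, fun i hi h1 h2 => ?_⟩
  · simpa [htl] using hs t ht
  · simpa [htl.symm] using hs l hl
  · simpa [h1, h2] using hs i hi

variable [IsAlgClosed k]

theorem IsotropicEigen.eq_zero_of_pair (h : IsotropicEigen p g D) {t l : ℕ}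
    (ht : t ∈ Icc 1 g) (hl : l ∈ Icc 1 g) (htl : t ≠ l) (htt : g + 1 ≠ 2 * t)
    (hll : g + 1 ≠ 2 * l) (htl' : g + 1 ≠ t + l) : ∀ i ∈ Icc 1 g, D i t = 0 := by
  obtain ⟨s, -, h2, h3⟩ := h.exists_eq_mul_pair ht hl htl htt hll htl' (map_zero (Φ 2))
  obtain ⟨s', -, h2', -⟩ := h.exists_eq_mul_pair hl ht htl.symm hll htt (by omega)
    (map_zero (Φ 2))
  obtain ⟨s₁, e1, e2, -⟩ := h.exists_eq_mul_pair ht hl htl htt hll htl' (map_one (Φ 2))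
  obtain ⟨c, hc, hc'⟩ := exists_iterateFrobenius_two_fixed_ne p (k := k)
  obtain ⟨s₂, f1, f2, -⟩ := h.exists_eq_mul_pair ht hl htl htt hll htl' hc
  simp only [map_zero, map_one, mul_zero, mul_one, add_zero] at h2 h2' h3 e1 e2
  have hDtt : D t t = 0 := by
    apply (mul_eq_zero.1 _).resolve_right (sub_ne_zero.2 hc')
    linear_combination f2 - c * f1 - Φ 1 c * (e2 - e1) - (1 - Φ 1 c) * h2 +
      (c - 1) * Φ 1 c * h2'
  intro i hi
  by_cases hit : i = t
  · rw [hit, hDtt]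
  · by_cases hil : i = l
    · rw [hil, h2]
    · exact h3 i hi hit hil

theorem IsotropicEigen.eq_zero_of_ne_middle (h : IsotropicEigen p g D) (hg : 4 ≤ g) {t : ℕ}
    (ht : t ∈ Icc 1 g) (htt : g + 1 ≠ 2 * t) : ∀ i ∈ Icc 1 g, D i t = 0 := by
  have ht' := mem_Icc.1 ht
  by_cases h1 : t = 1 ∨ t = g
  · exact h.eq_zero_of_pair ht (l := 2) (mem_Icc.2 (by omega)) (by omega) htt (by omega)
      (by omega)
  · exact h.eq_zero_of_pair ht (l := 1) (mem_Icc.2 (by omega)) (by omega) htt (by omega)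
      (by omega)

theorem IsotropicEigen.eq_zero_of_middle {n : ℕ} (h : IsotropicEigen p (2 * n + 1) D)
    (hn : 2 ≤ n) : ∀ i ∈ Icc 1 (2 * n + 1), D i (n + 1) = 0 := by
  have m1 : 1 ∈ Icc 1 (2 * n + 1) := mem_Icc.2 (by omega)
  have m2 : 2 * n + 1 ∈ Icc 1 (2 * n + 1) := mem_Icc.2 (by omega)
  have m3 : n + 1 ∈ Icc 1 (2 * n + 1) := mem_Icc.2 (by omega)
  have key : ∀ y : k, Φ 2 y = y → y + Φ 1 y = (-1) ^ (n + 1) → ∃ s,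
      ∀ i ∈ Icc 1 (2 * n + 1), D i (n + 1) = s * ((if i = 1 then 1 else 0) +
        (if i = 2 * n + 1 then y else 0) + if i = n + 1 then 1 else 0) := by
    intro y hy hy'
    obtain ⟨s, hs⟩ := h (fun i => (if i = 1 then 1 else 0) + (if i = 2 * n + 1 then y else 0) +
        if i = n + 1 then 1 else 0)
      (fun i => by simp only [map_add, apply_ite (Φ 2), map_one, map_zero, hy])
      (by
        rw [dualityForm_odd, show (2 * n + 1) % 2 = 1 by omega, sub_eq_zero,
          sum_eq_single_of_mem 1 (mem_Icc.2 (by omega))]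
        · rw [if_neg (by omega), if_pos (by omega), if_neg (by omega), if_pos rfl,
            if_neg (by omega), if_neg (by omega), if_neg (by omega), if_neg (by omega),
            if_pos rfl]
          simp only [add_zero, zero_add, mul_one, map_one, one_mul, hy']
        · intro i hi hi1
          rw [mem_Icc] at hi
          rw [if_neg (by omega), if_neg (by omega), if_neg (by omega), if_neg (by omega),
            if_neg (by omega), if_neg (by omega)]
          simp)
      ⟨1, m1, by
        rw [if_pos rfl, if_neg (by omega), if_neg (by omega)]
        simp⟩
    refine ⟨s, fun i hi => ?_⟩
    rw [← hs i hi]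
    simp only [map_add, apply_ite (Φ 1), map_one, map_zero, mul_add, sum_add_distrib, mul_ite,
      mul_one, mul_zero, sum_ite_eq', if_pos m1, if_pos m2, if_pos m3]
    rw [h.eq_zero_of_ne_middle (by omega) m1 (by omega) i hi,
      h.eq_zero_of_ne_middle (by omega) m2 (by omega) i hi, zero_mul, zero_add, zero_add]
  obtain ⟨y, hy', hy⟩ := exists_add_iterateFrobenius_one_eq (p := p) (r := (-1 : k) ^ (n + 1))
    (by simp)
  obtain ⟨c, hc0, hc⟩ := exists_iterateFrobenius_one_eq_neg p (k := k)
  obtain ⟨s, hs⟩ := key y hy hy'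
  obtain ⟨s', hs'⟩ := key (y + c) (by rw [map_add, hy, iterateFrobenius_two_of_eq_neg p hc])
    (by rw [map_add, hc, ← hy']; ring)
  have e1 := hs 1 m1
  have e1' := hs' 1 m1
  have e2 := hs _ m2
  have e2' := hs' _ m2
  rw [if_pos rfl, if_neg (by omega), if_neg (by omega)] at e1 e1'
  rw [if_neg (by omega), if_pos rfl, if_neg (by omega)] at e2 e2'
  have hs0 : s = 0 := by
    apply (mul_eq_zero.1 _).resolve_right hc0
    linear_combination e2 - e2' + (y + c) * (e1' - e1)
  intro i hi
  rw [hs i hi, hs0, zero_mul]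

theorem IsotropicEigen.eq_zero (h : IsotropicEigen p g D) (hg : 4 ≤ g) :
    ∀ i ∈ Icc 1 g, ∀ l ∈ Icc 1 g, D i l = 0 := by
  intro i hi l hl
  by_cases hll : g + 1 = 2 * l
  · obtain ⟨n, rfl⟩ : ∃ n, l = n + 1 := ⟨l - 1, by omega⟩
    obtain rfl : g = 2 * n + 1 := by omega
    exact h.eq_zero_of_middle (by omega) i hi
  · exact h.eq_zero_of_ne_middle hg hl hll i hi

end

/-- Let `g ≥ 4` and `δ = (δ_il)` a nonzero `g×g` matrix with entries in
`𝔽_{p²}`. Then there is a tuple `(a_1, …, a_g) ∈ k^g`, linearly independent over `𝔽_{p²}`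
and satisfying the self-duality relations `R_g`, such that the `3×g` matrix with rows
`(σ²(a_i))_i`, `(a_i)_i` and `(σ(∑_l δ_il·a_l))_i` has rank 3. -/
theorem stmt16 (p : ℕ) [Fact p.Prime] (k : Type*) [Field k] [IsAlgClosed k] [CharP k p]
    (g : ℕ) (hg : 4 ≤ g) (δ : ℕ → ℕ → k)
    (hδF : ∀ i l, δ i l ^ p ^ 2 = δ i l)
    (hδne : ∃ i ∈ Finset.Icc 1 g, ∃ l ∈ Finset.Icc 1 g, δ i l ≠ 0) :
    ∃ a : ℕ → k,
      (∀ c : ℕ → k, (∀ i, c i ^ p ^ 2 = c i) →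
        ∑ i ∈ Finset.Icc 1 g, c i * a i = 0 → ∀ i ∈ Finset.Icc 1 g, c i = 0) ∧
      SelfDualRelations p g a ∧
      (Matrix.of fun (r : Fin 3) (j : Fin g) =>
          ![((frobeniusEquiv k p : RingAut k) ^ 2) (a ((j : ℕ) + 1)),
            a ((j : ℕ) + 1),
            frobeniusEquiv k p (∑ l ∈ Finset.Icc 1 g, δ ((j : ℕ) + 1) l * a l)] r).rank
        = 3 := by
  by_contra hcon
  push Not at hcon
  have hδ : ∀ i l, iterateFrobenius k p 2 (δ i l) = δ i l := fun i l => hδF i l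
  have hspan : ∀ a : ℕ → k, QuadIndependent p g a → SelfDualRelations p g a →
      ∃ r s : k, ∀ i ∈ Icc 1 g, iterateFrobenius k p 1 (∑ l ∈ Icc 1 g, δ i l * a l) =
        r * a i + s * iterateFrobenius k p 2 (a i) := by
    intro a ha ha'
    have hrank := hcon a ha ha'
    have hdep := mt (fun h => (LinearIndependent.rank_matrix h).trans (Fintype.card_fin 3)) hrank
    rw [Fintype.not_linearIndependent_iff] at hdep
    obtain ⟨r, hr, hr0⟩ := hdep
    have hrow : ∀ i ∈ Icc 1 g, r 0 * iterateFrobenius k p 2 (a i) + r 1 * a i +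
        r 2 * iterateFrobenius k p 1 (∑ l ∈ Icc 1 g, δ i l * a l) = 0 := by
      intro i hi
      rw [mem_Icc] at hi
      have := congrFun hr ⟨i - 1, by omega⟩
      simpa [Fin.sum_univ_three, frobeniusEquiv_pow_apply, Nat.sub_add_cancel hi.1,
        iterateFrobenius_def, Matrix.row] using this
    have hr2 : r 2 ≠ 0 := by
      intro h2
      obtain ⟨h1, h0⟩ := ha.eq_zero_of_frobenius_combination p hg (u := 0) (v := 0) (P := r 1)
        (Q := r 0) (X := 0) (Y := 0) (by simp) (by simp) (fun i hi => by
          have := hrow i hi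
          rw [h2] at this
          simpa [add_comm] using this)
      obtain ⟨j, hj⟩ := hr0
      fin_cases j
      exacts [hj h0, hj h1, hj h2]
    refine ⟨-r 1 / r 2, -r 0 / r 2, fun i hi => ?_⟩
    field_simp
    linear_combination hrow i hi
  have heig : IsotropicEigen p g (fun i l => iterateFrobenius k p 1 (δ i l)) :=
    fun v hv hiso ⟨l, hl, hvl⟩ => exists_eq_smul_of_isotropic p hg hspan hδ hv hiso hl hvl
  obtain ⟨i, hi, l, hl, hne⟩ := hδne
  exact hne ((map_eq_zero _).1 (heig.eq_zero hg i hi l hl))
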